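/- arXiv:2510.08387 — 2 statements merged into one kernel-verified Lean document; each statement's English description precedes it below -/
import Mathlib

section
/- Let F be a field with at least four elements. Then the action of PGL(2,F) on the projective line ℙ¹(F) is not 4-transitive: there exist two 4-tuples (x₁, x₂, x₃, x₄) and (y₁, y₂, y₃, y₄) of pairwise distinct points of ℙ¹(F) such that no F-linear automorphism g of F² has its induced map on ℙ¹(F) send xᵢ to yᵢ for all i = 1, 2, 3, 4. -/
/-- A linear endomorphism of `F²` that preserves the lines spanned by `(1, 0)`, `(0, 1)` and
`(1, 1)` is a scalar, so it preserves the slope of every other line. -/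
theorem eq_of_map_std_frame {F : Type*} [Field F] (g : (Fin 2 → F) →ₗ[F] (Fin 2 → F))
    {a b r s t u : F} (hr : r • ![1, 0] = g ![1, 0]) (hs : s • ![0, 1] = g ![0, 1])
    (ht : t • ![1, 1] = g ![1, 1]) (hu : u • ![1, b] = g ![1, a]) (hr0 : r ≠ 0) : a = b := by
  have key (c : F) : g ![1, c] = ![r, c * s] := by
    have h : (![1, c] : Fin 2 → F) = ![1, 0] + c • ![0, 1] := by
      ext i; fin_cases i <;> simp
    rw [h, map_add, map_smul, ← hr, ← hs]
    ext i; fin_cases i <;> simp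
  rw [key] at ht hu
  have ht₀ : t = r := by simpa using congrFun ht 0
  have ht₁ : t = s := by simpa using congrFun ht 1
  have hu₀ : u = r := by simpa using congrFun hu 0
  have hu₁ : u * b = a * s := by simpa using congrFun hu 1
  apply mul_right_cancel₀ hr0
  rw [← ht₀, ht₁, ← hu₁, hu₀, ← ht₀, ht₁, mul_comm]

/-- The points `(1 : 0)`, `(0 : 1)`, `(1 : 1)` and `(1 : c)` of the projective line are pairwise
distinct if `c` is neither `0` nor `1`. -/
theorem std_frame_pairwise_ne {F : Type*} [Field F] {c : F} (hc₀ : c ≠ 0) (hc₁ : c ≠ 1)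
    (h₁ : (![1, 0] : Fin 2 → F) ≠ 0) (h₂ : (![0, 1] : Fin 2 → F) ≠ 0)
    (h₃ : (![1, 1] : Fin 2 → F) ≠ 0) (h₄ : (![1, c] : Fin 2 → F) ≠ 0) :
    Projectivization.mk F _ h₁ ≠ Projectivization.mk F _ h₂ ∧
    Projectivization.mk F _ h₁ ≠ Projectivization.mk F _ h₃ ∧
    Projectivization.mk F _ h₁ ≠ Projectivization.mk F _ h₄ ∧
    Projectivization.mk F _ h₂ ≠ Projectivization.mk F _ h₃ ∧
    Projectivization.mk F _ h₂ ≠ Projectivization.mk F _ h₄ ∧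
    Projectivization.mk F _ h₃ ≠ Projectivization.mk F _ h₄ := by
  simp only [ne_eq, Projectivization.mk_eq_mk_iff', funext_iff, Fin.forall_fin_two]
  refine ⟨?_, ?_, ?_, ?_, ?_, ?_⟩ <;> rintro ⟨k, hk₀, hk₁⟩ <;> simp at hk₀ hk₁ <;> grind


/-- If `F` is a field with at least four elements, then the action of `PGL(2,F)` on the
projective line `ℙ¹(F)` is not 4-transitive: there are two 4-tuples of pairwise distinct
points of `ℙ¹(F)` such that no `F`-linear automorphism of `F²` induces a map on `ℙ¹(F)`
taking the first tuple to the second. -/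
theorem pgl2_not_four_transitive
    (F : Type*) [Field F] (hF : 4 ≤ Cardinal.mk F) :
    ∃ x₁ x₂ x₃ x₄ y₁ y₂ y₃ y₄ : Projectivization F (Fin 2 → F),
      (x₁ ≠ x₂ ∧ x₁ ≠ x₃ ∧ x₁ ≠ x₄ ∧ x₂ ≠ x₃ ∧ x₂ ≠ x₄ ∧ x₃ ≠ x₄) ∧
      (y₁ ≠ y₂ ∧ y₁ ≠ y₃ ∧ y₁ ≠ y₄ ∧ y₂ ≠ y₃ ∧ y₂ ≠ y₄ ∧ y₃ ≠ y₄) ∧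
      ∀ g : (Fin 2 → F) ≃ₗ[F] (Fin 2 → F),
        ¬ (Projectivization.map (g : (Fin 2 → F) →ₗ[F] (Fin 2 → F)) g.injective x₁ = y₁ ∧
           Projectivization.map (g : (Fin 2 → F) →ₗ[F] (Fin 2 → F)) g.injective x₂ = y₂ ∧
           Projectivization.map (g : (Fin 2 → F) →ₗ[F] (Fin 2 → F)) g.injective x₃ = y₃ ∧
           Projectivization.map (g : (Fin 2 → F) →ₗ[F] (Fin 2 → F)) g.injective x₄ = y₄) := by
  obtain ⟨a, ha⟩ := Cardinal.exists_notMem_of_length_lt [(0 : F), 1]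
    (lt_of_lt_of_le (by norm_num) hF)
  obtain ⟨b, hb⟩ := Cardinal.exists_notMem_of_length_lt [(0 : F), 1, a]
    (lt_of_lt_of_le (by norm_num) hF)
  simp only [List.mem_cons, List.not_mem_nil, or_false, not_or] at ha hb
  have h₁ : (![1, 0] : Fin 2 → F) ≠ 0 := by simp
  have h₂ : (![0, 1] : Fin 2 → F) ≠ 0 := by simp
  have h (c : F) : (![1, c] : Fin 2 → F) ≠ 0 := by simp
  refine ⟨.mk F _ h₁, .mk F _ h₂, .mk F _ (h 1), .mk F _ (h a),
    .mk F _ h₁, .mk F _ h₂, .mk F _ (h 1), .mk F _ (h b),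
    std_frame_pairwise_ne ha.1 ha.2 h₁ h₂ (h 1) (h a),
    std_frame_pairwise_ne hb.1 hb.2.1 h₁ h₂ (h 1) (h b), ?_⟩
  rintro g ⟨e₁, e₂, e₃, e₄⟩
  rw [Projectivization.map_mk, Projectivization.mk_eq_mk_iff'] at e₁ e₂ e₃ e₄
  obtain ⟨r, hr⟩ := e₁
  obtain ⟨s, hs⟩ := e₂
  obtain ⟨t, ht⟩ := e₃
  obtain ⟨u, hu⟩ := e₄
  have hr₀ : r ≠ 0 := by
    rintro rfl
    rw [zero_smul] at hr
    exact h₁ ((map_eq_zero_iff g g.injective).1 hr.symm)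
  exact hb.2.2 (eq_of_map_std_frame (g : (Fin 2 → F) →ₗ[F] (Fin 2 → F)) hr hs ht hu hr₀).symm
end

section
/- Let V be a vector space over the two-element field 𝔽₂ = ZMod 2 of dimension at least 3. Then the affine group AGL(V) does not act 4-transitively on V: there exist two 4-tuples (a₁, a₂, a₃, a₄) and (b₁, b₂, b₃, b₄) of pairwise distinct vectors of V such that no affine automorphism e of V (affine equivalence V ≃ᵃ[ZMod 2] V) satisfies e(aᵢ) = bᵢ for all i = 1, 2, 3, 4. -/
/-- An affine automorphism fixing `0` is additive. -/
theorem AffineEquiv.map_add_of_map_zero {k V : Type*} [Ring k] [AddCommGroup V] [Module k V]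
    (e : V ≃ᵃ[k] V) (h0 : e 0 = 0) (u v : V) : e (u + v) = e u + e v := by
  have hu : e u = e.linear u := by simpa [h0] using e.map_vadd 0 u
  rw [hu]
  exact e.map_vadd v u

/-- If `V` is a vector space over `𝔽₂` of dimension at least 3, then the affine group of
`V` does not act 4-transitively on `V`: there are two 4-tuples of pairwise distinct
vectors such that no affine automorphism of `V` carries the first tuple to the second. -/
theorem agl_not_four_transitive_zmod_two
    (V : Type*) [AddCommGroup V] [Module (ZMod 2) V]
    (hV : 3 ≤ Module.rank (ZMod 2) V) :
    ∃ a₁ a₂ a₃ a₄ b₁ b₂ b₃ b₄ : V,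
      (a₁ ≠ a₂ ∧ a₁ ≠ a₃ ∧ a₁ ≠ a₄ ∧ a₂ ≠ a₃ ∧ a₂ ≠ a₄ ∧ a₃ ≠ a₄) ∧
      (b₁ ≠ b₂ ∧ b₁ ≠ b₃ ∧ b₁ ≠ b₄ ∧ b₂ ≠ b₃ ∧ b₂ ≠ b₄ ∧ b₃ ≠ b₄) ∧
      ∀ e : V ≃ᵃ[ZMod 2] V,
        ¬ (e a₁ = b₁ ∧ e a₂ = b₂ ∧ e a₃ = b₃ ∧ e a₄ = b₄) := by
  obtain ⟨f, hf⟩ := Module.le_rank_iff (n := 3).mp (by exact_mod_cast hV)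
  have hne : ∀ i, f i ≠ 0 := hf.ne_zero
  have hinj : ∀ {i j}, i ≠ j → f i ≠ f j := fun h => hf.injective.ne h
  have hcomb := Fintype.linearIndependent_iff.mp hf
  have hsum : f 0 + f 1 ≠ 0 := fun h => by
    simpa using hcomb ![1, 1, 0] (by simpa [Fin.sum_univ_three] using h) 0
  have hplane : f 0 + f 1 ≠ f 2 := fun h => by
    simpa using hcomb ![1, 1, -1]
      (by simp only [Fin.sum_univ_three, Matrix.cons_val, one_smul, neg_smul, h, add_neg_cancel]) 0
  refine ⟨0, f 0, f 1, f 0 + f 1, 0, f 0, f 1, f 2,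
    ⟨(hne 0).symm, (hne 1).symm, hsum.symm, hinj (by decide), ?_, ?_⟩,
    ⟨(hne 0).symm, (hne 1).symm, (hne 2).symm, hinj (by decide), hinj (by decide),
      hinj (by decide)⟩, ?_⟩
  · simpa using hne 1
  · simpa using hne 0
  · rintro e ⟨h0, h1, h2, h3⟩
    rw [e.map_add_of_map_zero h0, h1, h2] at h3
    exact hplane h3
end
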